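/- Exact solution of the porous medium equation: for m > 1 and real parameters α, β, the function ρ(x,t) := [ (m−1)(x−α)² / (2m(m+1)(β−t)) ]^{1/(m−1)} satisfies ∂_t ρ(x,t) = ∂²_{xx}(ρ^m)(x,t) for all t < β and all x ≠ α. -/

import Mathlib

/-- Exact solution of the porous medium equation: for `m > 1` and parameters `α, β`, the
function `ρ(x,t) = ((m-1)(x-α)²/(2m(m+1)(β-t)))^{1/(m-1)}` satisfies
`∂_t ρ = ∂²_{xx}(ρ^m)` for all `t < β` and `x ≠ α`. -/
theorem stmt17 (m α β : ℝ) (hm : 1 < m) (ρ : ℝ → ℝ → ℝ)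
    (hρ : ∀ x t, ρ x t =
      ((m - 1) * (x - α) ^ 2 / (2 * m * (m + 1) * (β - t))) ^ (1 / (m - 1))) :
    ∀ x t, t < β → x ≠ α →
      deriv (fun s => ρ x s) t = deriv (deriv (fun y => ρ y t ^ m)) x := by
  intro x t ht hx
  have hm1 : m - 1 ≠ 0 := by linarith
  have hm1' : 0 < m - 1 := by linarith
  have hm0 : 0 < m := by linarith
  have hmp : 0 < m + 1 := by linarith
  have hb : 0 < β - t := by linarith
  have hxa : x - α ≠ 0 := sub_ne_zero.mpr hx
  have hxs : 0 < (x - α) ^ 2 := by positivity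
  set p : ℝ := 1 / (m - 1) with hp
  have hppos : 0 < p := by positivity
  set k : ℝ := (m - 1) / (2 * m * (m + 1) * (β - t)) with hk
  have hkpos : 0 < k := by positivity
  have hfun : (fun y => ρ y t ^ m) = fun y => (k * (y - α) ^ 2) ^ (p + 1) := by
    funext y
    rw [hρ, ← Real.rpow_mul (by positivity)]
    have h1 : p * m = p + 1 := by rw [hp]; field_simp; ring
    rw [h1]
    congr 1
    rw [hk]; ring
  have hB : ∀ y, HasDerivAt (fun y : ℝ => k * (y - α) ^ 2) (2 * k * (y - α)) y := by
    intro y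
    have := (((hasDerivAt_id y).sub_const α).pow 2).const_mul k
    refine HasDerivAt.congr_deriv this ?_
    simp; ring
  have hd1 : deriv (fun y => ρ y t ^ m)
      = fun y => 2 * k * (y - α) * (p + 1) * (k * (y - α) ^ 2) ^ p := by
    rw [hfun]
    funext y
    have := ((hB y).rpow_const (p := p + 1) (Or.inr (by linarith))).deriv
    rw [this, add_sub_cancel_right]
  have hBx : 0 < k * (x - α) ^ 2 := by positivity
  have hd2 : HasDerivAt (fun y => 2 * k * (y - α) * (p + 1) * (k * (y - α) ^ 2) ^ p)
      (2 * k * (p + 1) * (k * (x - α) ^ 2) ^ p +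
        2 * k * (x - α) * (p + 1) * (2 * k * (x - α) * p * (k * (x - α) ^ 2) ^ (p - 1))) x := by
    have h1 := (hB x).rpow_const (p := p) (Or.inl hBx.ne')
    have h2 : HasDerivAt (fun y : ℝ => 2 * k * (y - α) * (p + 1)) (2 * k * (p + 1)) x := by
      have := (((hasDerivAt_id x).sub_const α).const_mul (2 * k)).mul_const (p + 1)
      refine HasDerivAt.congr_deriv this ?_
      simp
    exact h2.mul h1
  have hd3 : HasDerivAt (fun s => ρ x s)
      (k * (x - α) ^ 2 / (β - t) * p * (k * (x - α) ^ 2) ^ (p - 1)) t := by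
    have hg : (fun s => ρ x s) =
        fun s => ((m - 1) * (x - α) ^ 2 / (2 * m * (m + 1) * (β - s))) ^ p := by
      funext s; exact hρ x s
    have hK : (m - 1) * (x - α) ^ 2 / (2 * m * (m + 1) * (β - t)) = k * (x - α) ^ 2 := by
      rw [hk]; ring
    have h0 : HasDerivAt (fun s : ℝ => 2 * m * (m + 1) * (β - s)) (2 * m * (m + 1) * (-1)) t :=
      ((hasDerivAt_id t).const_sub β).const_mul _
    have h1 : HasDerivAt (fun s : ℝ => (m - 1) * (x - α) ^ 2 / (2 * m * (m + 1) * (β - s)))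
        (k * (x - α) ^ 2 / (β - t)) t := by
      have := (hasDerivAt_const t ((m - 1) * (x - α) ^ 2)).div h0 (by positivity)
      refine HasDerivAt.congr_deriv this ?_
      rw [hk]; field_simp; ring
    have h2 := h1.rpow_const (p := p) (Or.inl (by rw [hK]; exact hBx.ne'))
    rw [hK] at h2
    rw [hg]; exact h2
  rw [hd1, hd2.deriv, hd3.deriv]
  have hpw : (k * (x - α) ^ 2) ^ p = (k * (x - α) ^ 2) ^ (p - 1) * (k * (x - α) ^ 2) := by
    rw [← Real.rpow_add_one hBx.ne', sub_add_cancel]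
  rw [hpw]
  generalize (k * (x - α) ^ 2) ^ (p - 1) = Z
  have key : p / (β - t) = 2 * k * (p + 1) * (2 * p + 1) := by
    rw [hk, hp]; field_simp; ring
  linear_combination (k * (x - α) ^ 2 * Z) * key
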